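/- Let a ground normal logic program over N atoms with R rules be given, let I be an interpretation with complementary interpretation vector w and body-truth vector z defined by z i = 1 - min 1 ((Q.mulVec (fun p => 1 - w p)) i). Let L : Finset (Fin N) with indicator row ℓ and external support matrix ES. Then ℓ ⬝ᵥ (ES.mulVec z) equals the number of pairs (j, i) with j ∈ L such that rule i is an external support of L with h i = j and the body of rule i is satisfied by I; in particular ℓ ⬝ᵥ (ES.mulVec z) ≥ 1 if and only if some external support rule of L has its body satisfied by I. -/

import Mathlib

open Matrix

/-- Interpretation vector: indicator of `I`. -/
noncomputable def interpVec {N : ℕ} (I : Finset (Fin N)) : Fin N → ℝ :=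
  fun j => if j ∈ I then 1 else 0

/-- Complementary interpretation vector. -/
noncomputable def compVec {N : ℕ} (I : Finset (Fin N)) : Fin N ⊕ Fin N → ℝ :=
  Sum.elim (interpVec I) (fun j => 1 - interpVec I j)

/-- Program matrix of a ground normal logic program (also used for constraints). -/
noncomputable def progMat {N R : ℕ} (pos neg : Fin R → Finset (Fin N)) :
    Matrix (Fin R) (Fin N ⊕ Fin N) ℝ :=
  fun i => Sum.elim (fun j => if j ∈ pos i then 1 else 0)
                    (fun j => if j ∈ neg i then 1 else 0)

/-- Head matrix of a ground normal logic program. -/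
noncomputable def headMat {N R : ℕ} (h : Fin R → Fin N) : Matrix (Fin N) (Fin R) ℝ :=
  fun j i => if h i = j then 1 else 0

/-- The body of rule `i` is satisfied by interpretation `I`. -/
def BodySat {N R : ℕ} (pos neg : Fin R → Finset (Fin N)) (I : Finset (Fin N))
    (i : Fin R) : Prop :=
  pos i ⊆ I ∧ neg i ∩ I = ∅

/-- `I` satisfies the Clark completion of the program. -/
def SatComp {N R : ℕ} (h : Fin R → Fin N) (pos neg : Fin R → Finset (Fin N))
    (I : Finset (Fin N)) : Prop :=
  ∀ j : Fin N, j ∈ I ↔ ∃ i : Fin R, h i = j ∧ BodySat pos neg I i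

instance {N R : ℕ} {pos neg : Fin R → Finset (Fin N)} {I : Finset (Fin N)} {i : Fin R} :
    Decidable (BodySat pos neg I i) :=
  inferInstanceAs (Decidable (_ ∧ _))

/-- Body-truth vector `z`. -/
noncomputable def bodyVec {N R : ℕ} (pos neg : Fin R → Finset (Fin N))
    (I : Finset (Fin N)) : Fin R → ℝ :=
  fun i => 1 - min 1 ((progMat pos neg).mulVec (fun p => 1 - compVec I p) i)

/-- Indicator row of a set of atoms. -/
noncomputable def indRow {N : ℕ} (L : Finset (Fin N)) : Fin N → ℝ :=
  fun j => if j ∈ L then 1 else 0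

/-- Rule `i` is an external support of `L`. -/
def ExtSupport {N R : ℕ} (h : Fin R → Fin N) (pos : Fin R → Finset (Fin N))
    (L : Finset (Fin N)) (i : Fin R) : Prop :=
  h i ∈ L ∧ pos i ∩ L = ∅

instance {N R : ℕ} {h : Fin R → Fin N} {pos : Fin R → Finset (Fin N)}
    {L : Finset (Fin N)} {i : Fin R} : Decidable (ExtSupport h pos L i) :=
  inferInstanceAs (Decidable (_ ∧ _))

/-- External support matrix of `L`. -/
noncomputable def esMat {N R : ℕ} (h : Fin R → Fin N) (pos : Fin R → Finset (Fin N))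
    (L : Finset (Fin N)) : Matrix (Fin N) (Fin R) ℝ :=
  fun j i => if h i = j ∧ ExtSupport h pos L i then 1 else 0

/-- The number of false literals in the body of rule `i`. -/
lemma progMat_mulVec_one_sub_compVec {N R : ℕ} (pos neg : Fin R → Finset (Fin N))
    (I : Finset (Fin N)) (i : Fin R) :
    (progMat pos neg).mulVec (fun p => 1 - compVec I p) i =
      ((pos i \ I).card + (neg i ∩ I).card : ℕ) := by
  have hpos (j : Fin N) : (if j ∈ pos i then (1 : ℝ) else 0) * (1 - if j ∈ I then 1 else 0) =
      if j ∈ pos i \ I then 1 else 0 := by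
    by_cases hj : j ∈ pos i <;> by_cases hI : j ∈ I <;> simp [hj, hI]
  have hneg (j : Fin N) : (if j ∈ neg i then (1 : ℝ) else 0) * (if j ∈ I then 1 else 0) =
      if j ∈ neg i ∩ I then 1 else 0 := by
    by_cases hj : j ∈ neg i <;> by_cases hI : j ∈ I <;> simp [hj, hI]
  simp only [mulVec, dotProduct, progMat, compVec, interpVec, Fintype.sum_sum_type, Sum.elim_inl,
    Sum.elim_inr, sub_sub_cancel, hpos, hneg, Finset.sum_boole, Finset.filter_univ_mem,
    Nat.cast_add]

lemma bodyVec_apply {N R : ℕ} (pos neg : Fin R → Finset (Fin N)) (I : Finset (Fin N))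
    (i : Fin R) : bodyVec pos neg I i = if BodySat pos neg I i then 1 else 0 := by
  have hsat : BodySat pos neg I i ↔ (pos i \ I).card + (neg i ∩ I).card = 0 := by
    simp only [BodySat, Nat.add_eq_zero_iff, Finset.card_eq_zero, Finset.sdiff_eq_empty_iff_subset]
  rw [bodyVec, progMat_mulVec_one_sub_compVec]
  split_ifs with hi
  · simp [hsat.1 hi]
  · rw [min_eq_left, sub_self]
    exact_mod_cast Nat.one_le_iff_ne_zero.2 (mt hsat.2 hi)

theorem stmt_10 {N R : ℕ} (h : Fin R → Fin N) (pos neg : Fin R → Finset (Fin N))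
    (I : Finset (Fin N)) (L : Finset (Fin N)) :
    indRow L ⬝ᵥ (esMat h pos L).mulVec (bodyVec pos neg I) =
      (((L ×ˢ (Finset.univ : Finset (Fin R))).filter
        (fun q : Fin N × Fin R =>
          h q.2 = q.1 ∧ ExtSupport h pos L q.2 ∧ BodySat pos neg I q.2)).card : ℝ) ∧
    (1 ≤ indRow L ⬝ᵥ (esMat h pos L).mulVec (bodyVec pos neg I) ↔
      ∃ i : Fin R, ExtSupport h pos L i ∧ BodySat pos neg I i) := by
  have hcount : indRow L ⬝ᵥ (esMat h pos L).mulVec (bodyVec pos neg I) =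
      (((L ×ˢ (Finset.univ : Finset (Fin R))).filter
        (fun q : Fin N × Fin R =>
          h q.2 = q.1 ∧ ExtSupport h pos L q.2 ∧ BodySat pos neg I q.2)).card : ℝ) := by
    simp only [← Finset.sum_boole, Finset.sum_product, dotProduct, mulVec, indRow, esMat,
      bodyVec_apply, ite_mul, one_mul, zero_mul, Finset.sum_ite_mem, Finset.univ_inter,
      ← ite_and, and_assoc]
  refine ⟨hcount, ?_⟩
  rw [hcount, Nat.one_le_cast, Nat.one_le_iff_ne_zero, Finset.card_ne_zero]
  constructor
  · rintro ⟨q, hq⟩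
    exact ⟨q.2, (Finset.mem_filter.1 hq).2.2⟩
  · rintro ⟨i, hi⟩
    exact ⟨(h i, i), by simp [hi, hi.1.1]⟩
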